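/- arXiv:0708.3385 — 5 statements merged into one kernel-verified Lean document; each statement's English description precedes it below -/
import Mathlib

section
/- Let F be the free group on generators a and b, and let H be the kernel of the homomorphism F → ℤ/2ℤ sending a ↦ 1 and b ↦ 0 (so H consists of all elements whose total exponent sum in a is even, and H has index 2 in F). Then there exists a unique group homomorphism ψ : H → F satisfying ψ(a²) = 1, ψ(b) = b⁻¹a⁻¹, and ψ(a⁻¹ba) = b. -/
/-- F is the free group on two generators a and b. -/
abbrev F : Type := FreeGroup Bool

def a : F := FreeGroup.of false
def b : F := FreeGroup.of true

/-- The homomorphism F → ℤ/2ℤ sending a ↦ 1 and b ↦ 0. -/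
def toZ2 : F →* Multiplicative (ZMod 2) :=
  FreeGroup.lift fun s => Multiplicative.ofAdd (if s then (0 : ZMod 2) else 1)

/-- H is the kernel: the elements whose total exponent sum in a is even. -/
def H : Subgroup F := toZ2.ker

theorem mem_H {w : F} : w ∈ H ↔ toZ2 w = 1 := MonoidHom.mem_ker

theorem toZ2_a : toZ2 a = Multiplicative.ofAdd 1 := by simp [toZ2, a]

theorem toZ2_b : toZ2 b = 1 := by simp [toZ2, b]

theorem a_sq_mem_H : a ^ 2 ∈ H := by
  rw [mem_H, map_pow, toZ2_a]; decide

theorem b_mem_H : b ∈ H := mem_H.2 toZ2_b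

theorem conj_b_mem_H : a⁻¹ * b * a ∈ H := by
  simp [mem_H, toZ2_b]

theorem mem_or_mul_a_mem {K : Subgroup F} (ha : a ^ 2 ∈ K) (hb : b ∈ K)
    (hc : a⁻¹ * b * a ∈ K) (w : F) : w ∈ K ∨ w * a ∈ K := by
  have hw : w ∈ Subgroup.closure (Set.range (FreeGroup.of : Bool → F)) := by
    rw [FreeGroup.closure_range_of]
    exact Subgroup.mem_top w
  induction hw using Subgroup.closure_induction_right with
  | one => exact .inl K.one_mem
  | mul_right x y _ hy ih =>
    obtain ⟨_ | _, rfl⟩ := hy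
    · change x * a ∈ K ∨ x * a * a ∈ K
      refine ih.symm.imp id fun h => ?_
      simpa [pow_two, mul_assoc] using K.mul_mem h ha
    · change x * b ∈ K ∨ x * b * a ∈ K
      refine ih.imp (fun h => K.mul_mem h hb) fun h => ?_
      simpa [mul_assoc] using K.mul_mem h hc
  | mul_inv_cancel x y _ hy ih =>
    obtain ⟨_ | _, rfl⟩ := hy
    · change x * a⁻¹ ∈ K ∨ x * a⁻¹ * a ∈ K
      refine ih.symm.imp (fun h => ?_) fun h => by simpa using h
      simpa [pow_two, mul_assoc] using K.mul_mem h (K.inv_mem ha)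
    · change x * b⁻¹ ∈ K ∨ x * b⁻¹ * a ∈ K
      refine ih.imp (fun h => K.mul_mem h (K.inv_mem hb)) fun h => ?_
      simpa [mul_assoc] using K.mul_mem h (K.inv_mem hc)

theorem H_eq_closure : H = Subgroup.closure {a ^ 2, b, a⁻¹ * b * a} := by
  have hle : Subgroup.closure {a ^ 2, b, a⁻¹ * b * a} ≤ H := by
    rw [Subgroup.closure_le]
    rintro _ (rfl | rfl | rfl)
    exacts [a_sq_mem_H, b_mem_H, conj_b_mem_H]
  refine le_antisymm (fun w hw => ?_) hle
  refine (mem_or_mul_a_mem (Subgroup.subset_closure (by simp))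
    (Subgroup.subset_closure (by simp)) (Subgroup.subset_closure (by simp)) w).resolve_right
    fun h => ?_
  have ha : toZ2 a = 1 := mem_H.1 ((H.mul_mem_cancel_left hw).1 (hle h))
  rw [toZ2_a] at ha
  exact absurd ha (by decide)

/-- The action of ℤ/2ℤ on `G × G` exchanging the two factors. -/
def swapAction (G : Type*) [Group G] : Multiplicative (ZMod 2) →* MulAut (G × G) where
  toFun x := if x = 1 then 1 else MulEquiv.prodComm
  map_one' := if_pos rfl
  map_mul' x y := by
    revert x y
    change ∀ x y : ZMod 2, _
    intro x y
    fin_cases x <;> fin_cases y <;> rfl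

theorem swapAction_ofAdd_one {G : Type*} [Group G] (p : G × G) :
    swapAction G (Multiplicative.ofAdd 1) p = p.swap := rfl

/-- The homomorphism `F → (G × G) ⋊ ℤ/2ℤ` sending `a` to the swap and `b` to `(r, s)`. -/
def toWreath {G : Type*} [Group G] (r s : G) :
    F →* (G × G) ⋊[swapAction G] Multiplicative (ZMod 2) :=
  FreeGroup.lift fun t =>
    if t then SemidirectProduct.inl (r, s)
    else SemidirectProduct.inr (Multiplicative.ofAdd 1)

section toWreath

variable {G : Type*} [Group G] (r s : G)

theorem toWreath_a : toWreath r s a = SemidirectProduct.inr (Multiplicative.ofAdd 1) := by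
  simp [toWreath, a]

theorem toWreath_b : toWreath r s b = SemidirectProduct.inl (r, s) := by
  simp [toWreath, b]

theorem toWreath_right (w : F) : (toWreath r s w).right = toZ2 w := by
  have h : SemidirectProduct.rightHom.comp (toWreath r s) = toZ2 := by
    ext t
    cases t <;> simp [toWreath, toZ2]
  exact DFunLike.congr_fun h w

/-- The homomorphism `H → G` sending `a²`, `b`, `a⁻¹ba` to `1`, `r`, `s`. -/
def liftH : H →* G where
  toFun u := (toWreath r s u).left.1
  map_one' := by simp
  map_mul' u v := by
    simp [toWreath_right, mem_H.1 u.2]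

variable {r s}

theorem liftH_a_sq {u : H} (hu : (u : F) = a ^ 2) : liftH r s u = 1 := by
  simp [liftH, hu, toWreath_a, pow_two]

theorem liftH_b {u : H} (hu : (u : F) = b) : liftH r s u = r := by
  simp [liftH, hu, toWreath_b]

theorem liftH_conj_b {u : H} (hu : (u : F) = a⁻¹ * b * a) : liftH r s u = s := by
  change (toWreath r s (u : F)).left.1 = s
  rw [hu, map_mul, map_mul, map_inv, toWreath_a, toWreath_b]
  simp [← ofAdd_neg, swapAction_ofAdd_one]

end toWreath

/-- There exists a unique group homomorphism ψ : H → F with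
ψ(a²) = 1, ψ(b) = b⁻¹a⁻¹ and ψ(a⁻¹ba) = b. -/
theorem stmt8 :
    ∃! ψ : H →* F,
      (∀ u : H, (u : F) = a ^ 2 → ψ u = 1) ∧
      (∀ u : H, (u : F) = b → ψ u = b⁻¹ * a⁻¹) ∧
      (∀ u : H, (u : F) = a⁻¹ * b * a → ψ u = b) := by
  refine ⟨liftH (b⁻¹ * a⁻¹) b,
    ⟨fun _ => liftH_a_sq, fun _ => liftH_b, fun _ => liftH_conj_b⟩, ?_⟩
  rintro ψ ⟨h₁, h₂, h₃⟩
  have hle : H ≤ (ψ.eqLocus (liftH (b⁻¹ * a⁻¹) b)).map H.subtype := by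
    refine H_eq_closure.le.trans ((Subgroup.closure_le _).2 ?_)
    rintro _ (rfl | rfl | rfl)
    · exact ⟨⟨_, a_sq_mem_H⟩, (h₁ _ rfl).trans (liftH_a_sq rfl).symm, rfl⟩
    · exact ⟨⟨_, b_mem_H⟩, (h₂ _ rfl).trans (liftH_b rfl).symm, rfl⟩
    · exact ⟨⟨_, conj_b_mem_H⟩, (h₃ _ rfl).trans (liftH_conj_b rfl).symm, rfl⟩
  ext1 u
  obtain ⟨v, hv, hvu⟩ := hle u.2
  obtain rfl : v = u := Subtype.ext hvu
  exact hv
end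

section
/- For every integer n and every w ∈ F, the element (a^{2n})^w lies in H and ψ((a^{2n})^w) = 1. -/
/-- The coset representatives of `H` in `F` are `1` and `a`. -/
theorem mem_H_or_inv_a_mul_mem_H (w : F) : w ∈ H ∨ a⁻¹ * w ∈ H := by
  simp only [H, MonoidHom.mem_ker, map_mul, map_inv, toZ2_a]
  generalize toZ2 w = x
  revert x
  decide

/-- Conjugating a power of `a` by any `w` agrees with conjugating it by an element of `H`. -/
theorem exists_mem_H_conj_zpow_eq (m : ℤ) (w : F) :
    ∃ h ∈ H, w⁻¹ * a ^ m * w = h⁻¹ * a ^ m * h := by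
  rcases mem_H_or_inv_a_mul_mem_H w with hw | hw
  · exact ⟨w, hw, rfl⟩
  · exact ⟨a⁻¹ * w, hw, by group⟩

/-- For every n ∈ ℤ and w ∈ F, (a^{2n})^w ∈ H and ψ((a^{2n})^w) = 1. -/
theorem stmt9 (ψ : H →* F)
    (hψa2 : ∀ u : H, (u : F) = a ^ 2 → ψ u = 1)
    (hψb : ∀ u : H, (u : F) = b → ψ u = b⁻¹ * a⁻¹)
    (hψc : ∀ u : H, (u : F) = a⁻¹ * b * a → ψ u = b)
    (n : ℤ) (w : F) :
    w⁻¹ * a ^ (2 * n) * w ∈ H ∧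
    ∀ h : w⁻¹ * a ^ (2 * n) * w ∈ H, ψ ⟨w⁻¹ * a ^ (2 * n) * w, h⟩ = 1 := by
  obtain ⟨h, hh, heq⟩ := exists_mem_H_conj_zpow_eq (2 * n) w
  let s : H := ⟨a ^ 2, a_sq_mem_H⟩
  let g : H := ⟨h, hh⟩
  have hconj : w⁻¹ * a ^ (2 * n) * w = ((g⁻¹ * s ^ n * g : H) : F) := by
    rw [heq]
    simp [s, g, zpow_mul]
  refine ⟨hconj ▸ SetLike.coe_mem _, fun hmem => ?_⟩
  have hsub : (⟨w⁻¹ * a ^ (2 * n) * w, hmem⟩ : H) = g⁻¹ * s ^ n * g := Subtype.ext hconj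
  rw [hsub, map_mul, map_mul, map_zpow, map_inv, hψa2 s rfl]
  simp
end

section
/- For every w ∈ F one has |ψ̂(w)| ≤ |w|, where |·| denotes word length with respect to the generating set {a, a⁻¹, b, b⁻¹, c, c⁻¹} with c = b⁻¹a⁻¹. -/
/-- The generating set S = {a, a⁻¹, b, b⁻¹, c, c⁻¹}, where c = b⁻¹a⁻¹. -/
def S : Set F := {a, a⁻¹, b, b⁻¹, b⁻¹ * a⁻¹, (b⁻¹ * a⁻¹)⁻¹}

/-- The word length of w with respect to S: the least n such that w is
a product of n elements of S. -/
noncomputable def wordLen (w : F) : ℕ :=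
  sInf {n : ℕ | ∃ l : List F, l.length = n ∧ (∀ s ∈ l, s ∈ S) ∧ l.prod = w}

theorem b_mul_mem_H_iff (w : F) : b * w ∈ H ↔ w ∈ H := H.mul_mem_cancel_left b_mem_H

theorem a_mul_mem_H_iff (w : F) : a * w ∈ H ↔ w ∉ H := by
  simp only [H, MonoidHom.mem_ker, map_mul, toZ2_a]
  generalize toZ2 w = z
  revert z
  decide

theorem inv_a_mul_mem_H_iff (w : F) : a⁻¹ * w ∈ H ↔ w ∉ H := by
  rw [← not_iff_not, ← a_mul_mem_H_iff, mul_inv_cancel_left, not_not]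

theorem inv_mem_S {g : F} (hg : g ∈ S) : g⁻¹ ∈ S := by
  simp only [S, Set.mem_insert_iff, Set.mem_singleton_iff] at hg ⊢
  rcases hg with rfl | rfl | rfl | rfl | rfl | rfl <;> simp

theorem exists_list_prod_eq (w : F) : ∃ l : List F, (∀ s ∈ l, s ∈ S) ∧ l.prod = w := by
  induction w using FreeGroup.induction_on with
  | C1 => exact ⟨[], by simp⟩
  | of x => cases x <;> exact ⟨[_], by simp [S, a, b], List.prod_singleton⟩
  | inv_of x _ => cases x <;> exact ⟨[_], by simp [S, a, b], List.prod_singleton⟩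
  | mul x y hx hy =>
    obtain ⟨l, hl, rfl⟩ := hx
    obtain ⟨m, hm, rfl⟩ := hy
    exact ⟨l ++ m, fun s hs => (List.mem_append.1 hs).elim (hl s) (hm s), List.prod_append⟩

theorem wordLen_le_of_list {l : List F} (hl : ∀ s ∈ l, s ∈ S) : wordLen l.prod ≤ l.length :=
  Nat.sInf_le ⟨l, rfl, hl, rfl⟩

theorem exists_list_length_eq_wordLen (w : F) :
    ∃ l : List F, l.length = wordLen w ∧ (∀ s ∈ l, s ∈ S) ∧ l.prod = w := by
  obtain ⟨l, hl, hw⟩ := exists_list_prod_eq w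
  exact Nat.sInf_mem (s := {n | ∃ l : List F, l.length = n ∧ (∀ s ∈ l, s ∈ S) ∧ l.prod = w})
    ⟨_, l, rfl, hl, hw⟩

/-- A map fixing `1` for which left multiplication by a generator changes the value by at most
one generator does not increase word length. -/
theorem wordLen_map_le {f : F → F} (h_one : f 1 = 1)
    (h_mul : ∀ s ∈ S, ∀ w, f (s * w) = f w ∨ ∃ g ∈ S, f (s * w) = g * f w) (w : F) :
    wordLen (f w) ≤ wordLen w := by
  have key (l : List F) (hl : ∀ s ∈ l, s ∈ S) :
      ∃ m : List F, m.length ≤ l.length ∧ (∀ s ∈ m, s ∈ S) ∧ m.prod = f l.prod := by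
    induction l with
    | nil => exact ⟨[], by simp [h_one]⟩
    | cons s l ih =>
      obtain ⟨m, hlen, hm, hprod⟩ := ih fun t ht => hl t (List.mem_cons_of_mem _ ht)
      rcases h_mul s (hl s List.mem_cons_self) l.prod with h | ⟨g, hg, h⟩
      · exact ⟨m, by simp only [List.length_cons]; lia, hm, by rw [List.prod_cons, h, hprod]⟩
      · exact ⟨g :: m, by simpa using hlen, List.forall_mem_cons.2 ⟨hg, hm⟩,
          by rw [List.prod_cons, List.prod_cons, h, hprod]⟩
  obtain ⟨l, hlen, hl, rfl⟩ := exists_list_length_eq_wordLen w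
  obtain ⟨m, hlen', hm, hprod⟩ := key l hl
  rw [← hprod, ← hlen]
  exact (wordLen_le_of_list hm).trans hlen'

/-- For every w ∈ F, |ψ̂(w)| ≤ |w|. -/
theorem stmt13 (ψ : H →* F)
    (hψa2 : ∀ u : H, (u : F) = a ^ 2 → ψ u = 1)
    (hψb : ∀ u : H, (u : F) = b → ψ u = b⁻¹ * a⁻¹)
    (hψc : ∀ u : H, (u : F) = a⁻¹ * b * a → ψ u = b)
    (ψh : F → F)
    (hψh₁ : ∀ (w : F) (h : w ∈ H), ψh w = ψ ⟨w, h⟩)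
    (hψh₂ : ∀ (w : F), w ∉ H → ∀ h : a⁻¹ * w ∈ H, ψh w = ψ ⟨a⁻¹ * w, h⟩)
    (w : F) :
    wordLen (ψh w) ≤ wordLen w := by
  have ψ_mul {x y z : F} (hx : x ∈ H) (hy : y ∈ H) (hz : z ∈ H) (h : z = x * y) :
      ψ ⟨z, hz⟩ = ψ ⟨x, hx⟩ * ψ ⟨y, hy⟩ := by
    subst h
    exact map_mul ψ ⟨x, hx⟩ ⟨y, hy⟩
  have ψh_a_mul (v : F) : ψh (a * v) = ψh v := by
    by_cases hv : v ∈ H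
    · have hav : a * v ∉ H := by simpa [a_mul_mem_H_iff] using hv
      have hmem : a⁻¹ * (a * v) ∈ H := by simpa using hv
      rw [hψh₁ v hv, hψh₂ _ hav hmem]
      simp
    · have hav : a * v ∈ H := (a_mul_mem_H_iff v).2 hv
      have hmem : a⁻¹ * v ∈ H := (inv_a_mul_mem_H_iff v).2 hv
      have ha2 : a ^ 2 ∈ H := by
        rw [pow_two, a_mul_mem_H_iff, ← mul_one a, a_mul_mem_H_iff]
        simp [H.one_mem]
      rw [hψh₁ _ hav, hψh₂ v hv hmem, ψ_mul ha2 hmem hav (by group), hψa2 _ rfl, one_mul]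
  have ψh_b_mul (v : F) : ∃ g ∈ S, ψh (b * v) = g * ψh v := by
    by_cases hv : v ∈ H
    · have hbv : b * v ∈ H := (b_mul_mem_H_iff v).2 hv
      refine ⟨b⁻¹ * a⁻¹, by simp [S], ?_⟩
      rw [hψh₁ _ hbv, hψh₁ v hv, ψ_mul b_mem_H hv hbv rfl, hψb _ rfl]
    · have hbv : b * v ∉ H := (b_mul_mem_H_iff v).not.2 hv
      have hmem : a⁻¹ * v ∈ H := (inv_a_mul_mem_H_iff v).2 hv
      have hmem' : a⁻¹ * (b * v) ∈ H := (inv_a_mul_mem_H_iff _).2 hbv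
      have hconj : a⁻¹ * b * a ∈ H := by
        rw [mul_assoc, inv_a_mul_mem_H_iff, b_mul_mem_H_iff, ← mul_one a, a_mul_mem_H_iff]
        simp [H.one_mem]
      refine ⟨b, by simp [S], ?_⟩
      rw [hψh₂ _ hbv hmem', hψh₂ v hv hmem, ψ_mul hconj hmem hmem' (by group), hψc _ rfl]
  have ψh_inv_a_mul (v : F) : ψh (a⁻¹ * v) = ψh v := by
    rw [← ψh_a_mul, mul_inv_cancel_left]
  have ψh_inv_b_mul (v : F) : ∃ g ∈ S, ψh (b⁻¹ * v) = g * ψh v := by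
    obtain ⟨g, hg, h⟩ := ψh_b_mul (b⁻¹ * v)
    exact ⟨g⁻¹, inv_mem_S hg, by rw [mul_inv_cancel_left] at h; rw [h, inv_mul_cancel_left]⟩
  refine wordLen_map_le ?_ (fun s hs v => ?_) w
  · rw [hψh₁ 1 H.one_mem]
    exact map_one ψ
  · simp only [S, Set.mem_insert_iff, Set.mem_singleton_iff] at hs
    rcases hs with rfl | rfl | rfl | rfl | rfl | rfl
    · exact .inl (ψh_a_mul v)
    · exact .inl (ψh_inv_a_mul v)
    · exact .inr (ψh_b_mul v)
    · exact .inr (ψh_inv_b_mul v)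
    · rw [mul_assoc, ← ψh_inv_a_mul v]
      exact .inr (ψh_inv_b_mul _)
    · rw [mul_inv_rev, inv_inv, inv_inv, mul_assoc, ψh_a_mul]
      exact .inr (ψh_b_mul v)
end

section
/- Let σ : F → F be the group endomorphism determined by σ(a) = b⁻¹a⁻¹b⁻¹a and σ(b) = a⁻¹ba. Then the image of σ is contained in H, and ψ ∘ σ is the identity map of F; that is, ψ(σ(g)) = g for every g ∈ F. -/
/-- For the endomorphism σ with σ(a) = b⁻¹a⁻¹b⁻¹a and σ(b) = a⁻¹ba, the image of σ
is contained in H and ψ ∘ σ = id. -/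
theorem stmt15 (ψ : H →* F)
    (hψa2 : ∀ u : H, (u : F) = a ^ 2 → ψ u = 1)
    (hψb : ∀ u : H, (u : F) = b → ψ u = b⁻¹ * a⁻¹)
    (hψc : ∀ u : H, (u : F) = a⁻¹ * b * a → ψ u = b)
    (σ : F →* F)
    (hσa : σ a = b⁻¹ * a⁻¹ * b⁻¹ * a) (hσb : σ b = a⁻¹ * b * a) :
    ∀ g : F, σ g ∈ H ∧ ∀ h : σ g ∈ H, ψ ⟨σ g, h⟩ = g := by
  have hbH : b ∈ H := by simp [H, toZ2, b, MonoidHom.mem_ker]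
  have hcH : a⁻¹ * b * a ∈ H := by
    simp [H, toZ2, a, b, MonoidHom.mem_ker]
  have hσa' : σ a = b⁻¹ * (a⁻¹ * b * a)⁻¹ := by rw [hσa]; group
  have hmem : ∀ g : F, σ g ∈ H := by
    intro g
    induction g using FreeGroup.induction_on with
    | C1 => simp [H.one_mem]
    | of s =>
      cases s
      · change σ a ∈ H
        rw [hσa']
        exact H.mul_mem (H.inv_mem hbH) (H.inv_mem hcH)
      · change σ b ∈ H
        rwa [hσb]
    | inv_of s hs => rw [map_inv]; exact H.inv_mem hs
    | mul x y hx hy => rw [map_mul]; exact H.mul_mem hx hy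
  have hcomp : ψ.comp (σ.codRestrict H hmem) = MonoidHom.id F := by
    refine FreeGroup.ext_hom _ _ fun s => ?_
    cases s
    · change ψ (σ.codRestrict H hmem a) = a
      have hfac : σ.codRestrict H hmem a = (⟨b, hbH⟩ : H)⁻¹ * (⟨_, hcH⟩ : H)⁻¹ :=
        Subtype.ext hσa'
      rw [hfac, map_mul, map_inv, map_inv, hψb _ rfl, hψc _ rfl]
      group
    · exact hψc _ hσb
  exact fun g => ⟨hmem g, fun _ => DFunLike.congr_fun hcomp g⟩
end

section
/- Let σ : F → F be the group endomorphism determined by σ(a) = b⁻¹a⁻¹b⁻¹a and σ(b) = a⁻¹ba, and for n ≥ 1 set wₙ = a·σ(a)·σ^{∘2}(a)·…·σ^{∘(n-1)}(a). Then for every n ≥ 1 the element b^{wₙ} belongs to dom(ψ^{∘n}) and ψ^{∘n}(b^{wₙ}) = b. -/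
/-- g ∈ dom(ψ^{∘k}): dom(ψ^{∘0}) = F and dom(ψ^{∘(k+1)}) = {g ∈ H : ψ(g) ∈ dom(ψ^{∘k})}. -/
def inDom (ψ : H →* F) : ℕ → F → Prop
  | 0, _ => True
  | k + 1, g => ∃ h : g ∈ H, inDom ψ k (ψ ⟨g, h⟩)

open scoped Classical in
/-- The iterate ψ^{∘k}: ψ^{∘0} = id and ψ^{∘(k+1)}(g) = ψ^{∘k}(ψ(g))
(with junk value 1 outside the domain). -/
noncomputable def iterPsi (ψ : H →* F) : ℕ → F → F
  | 0, g => g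
  | k + 1, g => if h : g ∈ H then iterPsi ψ k (ψ ⟨g, h⟩) else 1

/-- An endomorphism with the given values on the generators takes values in `H`. -/
theorem sigma_mem_H (σ : F →* F) (hσa : σ a = b⁻¹ * a⁻¹ * b⁻¹ * a)
    (hσb : σ b = a⁻¹ * b * a) (g : F) : σ g ∈ H := by
  have h : toZ2.comp σ = 1 := by
    refine FreeGroup.ext_hom _ _ fun s => ?_
    cases s
    · change toZ2 (σ a) = 1
      simp [hσa, toZ2_b]
    · change toZ2 (σ b) = 1
      simp [hσb, toZ2_b]
  exact DFunLike.congr_fun h g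

/-- `σ` is a right inverse of `ψ`. -/
theorem psi_sigma (ψ : H →* F)
    (hψb : ∀ u : H, (u : F) = b → ψ u = b⁻¹ * a⁻¹)
    (hψc : ∀ u : H, (u : F) = a⁻¹ * b * a → ψ u = b)
    (σ : F →* F) (hσa : σ a = b⁻¹ * a⁻¹ * b⁻¹ * a) (hσb : σ b = a⁻¹ * b * a)
    (g : F) (hg : σ g ∈ H) : ψ ⟨σ g, hg⟩ = g := by
  have h : ψ.comp (σ.codRestrict H (sigma_mem_H σ hσa hσb)) = MonoidHom.id F := by
    refine FreeGroup.ext_hom _ _ fun s => ?_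
    cases s
    · change ψ ⟨σ a, _⟩ = a
      have e : (⟨σ a, sigma_mem_H σ hσa hσb a⟩ : H) =
          (⟨b, b_mem_H⟩ : H)⁻¹ * (⟨a⁻¹ * b * a, conj_b_mem_H⟩ : H)⁻¹ := by
        ext1
        simp [hσa, mul_assoc]
      rw [e, map_mul, map_inv, map_inv, hψb _ rfl, hψc _ rfl]
      group
    · exact hψc _ hσb
  exact DFunLike.congr_fun h g

/-- The conjugate `b^{wₙ₊₁}` is the image of `b^{wₙ}` under `σ`. -/
theorem conj_prod_succ (σ : F →* F) (hσb : σ b = a⁻¹ * b * a) (n : ℕ) :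
    ((List.range (n + 1)).map fun i => (⇑σ)^[i] a).prod⁻¹ * b *
        ((List.range (n + 1)).map fun i => (⇑σ)^[i] a).prod =
      σ (((List.range n).map fun i => (⇑σ)^[i] a).prod⁻¹ * b *
        ((List.range n).map fun i => (⇑σ)^[i] a).prod) := by
  have h : ((List.range (n + 1)).map fun i => (⇑σ)^[i] a).prod =
      a * σ ((List.range n).map fun i => (⇑σ)^[i] a).prod := by
    rw [List.range_succ_eq_map, map_list_prod, List.map_cons, List.prod_cons, List.map_map,
      List.map_map]
    simp only [Function.comp_def, Function.iterate_succ_apply', Function.iterate_zero, id_eq]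
  rw [h, map_mul, map_mul, map_inv, hσb]
  group

/-- With wₙ = a·σ(a)·…·σ^{∘(n-1)}(a): for every n ≥ 1, b^{wₙ} ∈ dom(ψ^{∘n}) and
ψ^{∘n}(b^{wₙ}) = b. -/
theorem stmt16 (ψ : H →* F)
    (hψa2 : ∀ u : H, (u : F) = a ^ 2 → ψ u = 1)
    (hψb : ∀ u : H, (u : F) = b → ψ u = b⁻¹ * a⁻¹)
    (hψc : ∀ u : H, (u : F) = a⁻¹ * b * a → ψ u = b)
    (σ : F →* F)
    (hσa : σ a = b⁻¹ * a⁻¹ * b⁻¹ * a) (hσb : σ b = a⁻¹ * b * a)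
    (n : ℕ) (hn : 1 ≤ n) :
    inDom ψ n (((List.range n).map fun i => (⇑σ)^[i] a).prod⁻¹ * b *
        ((List.range n).map fun i => (⇑σ)^[i] a).prod) ∧
      iterPsi ψ n (((List.range n).map fun i => (⇑σ)^[i] a).prod⁻¹ * b *
        ((List.range n).map fun i => (⇑σ)^[i] a).prod) = b := by
  clear hn hψa2
  induction n with
  | zero => exact ⟨trivial, by simp [iterPsi]⟩
  | succ n ih =>
    rw [conj_prod_succ σ hσb]
    have hH := sigma_mem_H σ hσa hσb (((List.range n).map fun i => (⇑σ)^[i] a).prod⁻¹ * b *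
      ((List.range n).map fun i => (⇑σ)^[i] a).prod)
    have hψσ := psi_sigma ψ hψb hψc σ hσa hσb _ hH
    refine ⟨⟨hH, ?_⟩, ?_⟩
    · rw [hψσ]
      exact ih.1
    · rw [iterPsi, dif_pos hH, hψσ]
      exact ih.2
end
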